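/- Let Φ=(f_1,…,f_n) be a polynomial automorphism of K^n and let deg_1 be the standard homogeneous degree on K[x_1,…,x_n]. If the ideal of relations of Φ is principal, say I = (R), then deg_2(R) ≤ d_1 + ⋯ + d_n − n + 1. -/

import Mathlib

open MvPolynomial

/-- Leading term of a polynomial with respect to the standard homogeneous degree. -/
noncomputable def ltStd {K : Type*} [CommSemiring K] {n : ℕ}
    (p : MvPolynomial (Fin n) K) : MvPolynomial (Fin n) K :=
  homogeneousComponent p.totalDegree p

/-- The ideal of relations between the leading terms (for the standard degree) of the
components of an automorphism. -/
noncomputable def relIdealStd {K : Type*} [CommRing K] {n : ℕ}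
    (f : Fin n → MvPolynomial (Fin n) K) : Ideal (MvPolynomial (Fin n) K) :=
  RingHom.ker
    (aeval (fun i => ltStd (f i)) : MvPolynomial (Fin n) K →ₐ[K] MvPolynomial (Fin n) K)

section Parachute

variable {K : Type*} [Field K] {n : ℕ}

/-- all monomials of `p` have weight at most `N`. -/
def WLe (w : Fin n → ℕ) (p : MvPolynomial (Fin n) K) (N : ℕ) : Prop :=
  ∀ d, coeff d p ≠ 0 → Finsupp.weight w d ≤ N

theorem WLe.mono {w : Fin n → ℕ} {p : MvPolynomial (Fin n) K} {N M : ℕ} (h : WLe w p N)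
    (hNM : N ≤ M) : WLe w p M := fun d hd => (h d hd).trans hNM

theorem wle_iff {w : Fin n → ℕ} {p : MvPolynomial (Fin n) K} {N : ℕ} :
    WLe w p N ↔ weightedTotalDegree w p ≤ N := by
  constructor
  · intro h
    exact Finset.sup_le fun d hd => h d (mem_support_iff.1 hd)
  · intro h d hd
    exact (le_weightedTotalDegree w (mem_support_iff.2 hd)).trans h

theorem wle_one_iff {p : MvPolynomial (Fin n) K} {N : ℕ} :
    WLe 1 p N ↔ p.totalDegree ≤ N := by
  rw [wle_iff, weightedTotalDegree_one]

theorem WLe.mul {w : Fin n → ℕ} {p q : MvPolynomial (Fin n) K} {a b : ℕ}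
    (hp : WLe w p a) (hq : WLe w q b) : WLe w (p * q) (a + b) := by
  classical
  intro d hd
  rw [coeff_mul] at hd
  obtain ⟨x, hx, hne⟩ := Finset.exists_ne_zero_of_sum_ne_zero hd
  have := hp _ (left_ne_zero_of_mul hne)
  have := hq _ (right_ne_zero_of_mul hne)
  rw [← Finset.HasAntidiagonal.mem_antidiagonal.1 hx, map_add]
  omega

theorem comp_mul {w : Fin n → ℕ} {p q : MvPolynomial (Fin n) K} {a b : ℕ}
    (hp : WLe w p a) (hq : WLe w q b) :
    weightedHomogeneousComponent w (a + b) (p * q) =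
      weightedHomogeneousComponent w a p * weightedHomogeneousComponent w b q := by
  classical
  ext d
  rw [coeff_weightedHomogeneousComponent, coeff_mul, coeff_mul]
  simp only [coeff_weightedHomogeneousComponent]
  split_ifs with h
  · refine Finset.sum_congr rfl fun x hx => ?_
    have hx' := Finset.HasAntidiagonal.mem_antidiagonal.1 hx
    have e : Finsupp.weight w x.1 + Finsupp.weight w x.2 = a + b := by
      rw [← map_add, hx', h]
    by_cases h1 : coeff x.1 p = 0
    · simp [h1]
    by_cases h2 : coeff x.2 q = 0
    · simp [h2]
    have := hp _ h1
    have := hq _ h2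
    rw [if_pos (by omega), if_pos (by omega)]
  · symm
    refine Finset.sum_eq_zero fun x hx => ?_
    have hx' := Finset.HasAntidiagonal.mem_antidiagonal.1 hx
    have e : Finsupp.weight w x.1 + Finsupp.weight w x.2 ≠ a + b := by
      rw [← map_add, hx']; exact h
    by_cases h1 : Finsupp.weight w x.1 = a
    · rw [if_neg (c := Finsupp.weight w x.2 = b) (by omega), mul_zero]
    · rw [if_neg h1, zero_mul]

theorem comp_top_ne_zero {w : Fin n → ℕ} {p : MvPolynomial (Fin n) K} (hp : p ≠ 0) :
    weightedHomogeneousComponent w (weightedTotalDegree w p) p ≠ 0 := by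
  classical
  obtain ⟨d, hd, he⟩ := Finset.exists_mem_eq_sup p.support (support_nonempty.2 hp)
    (fun s => Finsupp.weight w s)
  intro h
  have := congrArg (coeff d) h
  rw [coeff_weightedHomogeneousComponent, if_pos (by rw [← he]; rfl), coeff_zero] at this
  exact mem_support_iff.1 hd this

theorem WLe.one {w : Fin n → ℕ} : WLe w (1 : MvPolynomial (Fin n) K) 0 := by
  classical
  intro d hd
  rw [coeff_one] at hd
  have : 0 = d := by by_contra h; simp [h] at hd
  simp [← this]

theorem WLe.pow {w : Fin n → ℕ} {p : MvPolynomial (Fin n) K} {a : ℕ}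
    (hp : WLe w p a) (m : ℕ) : WLe w (p ^ m) (m * a) := by
  induction m with
  | zero => simpa using WLe.one
  | succ m ih =>
    rw [pow_succ, add_mul, one_mul]
    exact ih.mul hp

theorem comp_one {w : Fin n → ℕ} :
    weightedHomogeneousComponent w 0 (1 : MvPolynomial (Fin n) K) = 1 :=
  (isWeightedHomogeneous_one K w).weightedHomogeneousComponent_same

theorem comp_pow {w : Fin n → ℕ} {p : MvPolynomial (Fin n) K} {a : ℕ}
    (hp : WLe w p a) (m : ℕ) : weightedHomogeneousComponent w (m * a) (p ^ m) =
      weightedHomogeneousComponent w a p ^ m := by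
  induction m with
  | zero => simpa using comp_one
  | succ m ih =>
    rw [pow_succ, add_mul, one_mul, comp_mul (hp.pow m) hp, ih, pow_succ]

theorem comp_prod {w : Fin n → ℕ} {ι : Type*} (s : Finset ι)
    (p : ι → MvPolynomial (Fin n) K) (a : ι → ℕ) (hp : ∀ i, WLe w (p i) (a i)) :
    WLe w (∏ i ∈ s, p i) (∑ i ∈ s, a i) ∧
    weightedHomogeneousComponent w (∑ i ∈ s, a i) (∏ i ∈ s, p i) =
      ∏ i ∈ s, weightedHomogeneousComponent w (a i) (p i) := by
  classical
  induction s using Finset.induction_on with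
  | empty => simpa using ⟨WLe.one, comp_one⟩
  | insert i s hi ih =>
    rw [Finset.prod_insert hi, Finset.sum_insert hi, Finset.prod_insert hi]
    exact ⟨(hp i).mul ih.1, by rw [comp_mul (hp i) ih.1, ih.2]⟩

theorem wdeg_mul {w : Fin n → ℕ} {p q : MvPolynomial (Fin n) K} (hp : p ≠ 0) (hq : q ≠ 0) :
    weightedTotalDegree w p + weightedTotalDegree w q ≤ weightedTotalDegree w (p * q) := by
  by_contra! h
  have h1 := comp_mul (wle_iff.2 (le_refl (weightedTotalDegree w p)))
    (wle_iff.2 (le_refl (weightedTotalDegree w q)))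
  rw [weightedHomogeneousComponent_eq_zero _ _ h] at h1
  exact mul_ne_zero (comp_top_ne_zero hp) (comp_top_ne_zero hq) h1.symm

theorem wdeg_pow {w : Fin n → ℕ} {p : MvPolynomial (Fin n) K} (hp : p ≠ 0) (m : ℕ) :
    m * weightedTotalDegree w p ≤ weightedTotalDegree w (p ^ m) := by
  induction m with
  | zero => simp
  | succ m ih =>
    have := wdeg_mul (w := w) (pow_ne_zero m hp) hp
    rw [pow_succ, add_mul, one_mul]
    omega

/-- Component of degree `N` of `G(f)`. -/
theorem comp_aeval (f : Fin n → MvPolynomial (Fin n) K) (G : MvPolynomial (Fin n) K) (N : ℕ)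
    (hG : WLe (fun i => (f i).totalDegree) G N) :
    homogeneousComponent N (aeval f G) =
      aeval (fun i => ltStd (f i))
        (weightedHomogeneousComponent (fun i => (f i).totalDegree) N G) := by
  classical
  conv_lhs => rw [G.as_sum]
  conv_rhs => rw [G.as_sum]
  simp only [map_sum]
  refine Finset.sum_congr rfl fun s hs => ?_
  have hw := hG s (mem_support_iff.1 hs)
  have hwt : Finsupp.weight (fun i => (f i).totalDegree) s = ∑ i, s i * (f i).totalDegree := by
    rw [Finsupp.weight_apply, Finsupp.sum_fintype _ _ (by simp)]
    simp
  have hpr := comp_prod (w := 1) Finset.univ (fun i => f i ^ s i)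
    (fun i => s i * (f i).totalDegree) (fun i => (wle_one_iff.2 le_rfl).pow _)
  rw [← hwt] at hpr
  rw [aeval_monomial, Finsupp.prod_fintype _ _ (by simp), algebraMap_eq,
    homogeneousComponent_C_mul]
  rcases hw.lt_or_eq with h | h
  · rw [(isWeightedHomogeneous_monomial _ s _ rfl).weightedHomogeneousComponent_ne N h.ne',
      map_zero, homogeneousComponent_eq_zero, mul_zero]
    exact (wle_one_iff.1 hpr.1).trans_lt h
  · rw [← h, (isWeightedHomogeneous_monomial _ s _ rfl).weightedHomogeneousComponent_same,
      aeval_monomial, Finsupp.prod_fintype _ _ (by simp), algebraMap_eq]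
    congr 1
    refine hpr.2.trans (Finset.prod_congr rfl fun i _ => ?_)
    exact comp_pow (wle_one_iff.2 le_rfl) _

/-- chain rule -/
theorem chain_rule (f : Fin n → MvPolynomial (Fin n) K) (G : MvPolynomial (Fin n) K)
    (k : Fin n) :
    pderiv k (aeval f G) = ∑ j, aeval f (pderiv j G) * pderiv k (f j) := by
  classical
  induction G using MvPolynomial.induction_on with
  | C a => simp [algebraMap_eq]
  | add p q hp hq => simp only [map_add, hp, hq, add_mul, Finset.sum_add_distrib]
  | mul_X p i hp =>
    simp only [map_mul, aeval_X, pderiv_mul, hp, map_add, add_mul, Finset.sum_add_distrib]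
    congr 1
    · rw [Finset.sum_mul]
      exact Finset.sum_congr rfl fun j _ => by ring
    · rw [Finset.sum_eq_single i]
      · simp
      · intro j _ hj
        simp [pderiv_X_of_ne (Ne.symm hj)]
      · simp

theorem totalDegree_det_le (M : Matrix (Fin n) (Fin n) (MvPolynomial (Fin n) K))
    (r : Fin n → ℕ) (h : ∀ i j, (M i j).totalDegree ≤ r i) :
    M.det.totalDegree ≤ ∑ i, r i := by
  rw [Matrix.det_apply']
  refine totalDegree_finsetSum_le fun σ _ => ?_
  refine (totalDegree_mul _ _).trans ?_
  have h1 : (((Equiv.Perm.sign σ : ℤˣ) : ℤ) : MvPolynomial (Fin n) K).totalDegree = 0 := by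
    rw [← map_intCast (C (R := K) (σ := Fin n)), totalDegree_C]
  rw [h1, zero_add]
  refine (totalDegree_finsetProd _ _).trans ?_
  rw [← Equiv.sum_comp σ r]
  exact Finset.sum_le_sum fun i _ => h _ _

theorem totalDegree_pderiv_le (i : Fin n) (p : MvPolynomial (Fin n) K) :
    (pderiv i p).totalDegree ≤ p.totalDegree - 1 := by
  rw [← wle_one_iff]
  intro d hd
  rw [coeff_pderiv] at hd
  have := (wle_one_iff.2 (le_refl p.totalDegree)) _ (left_ne_zero_of_mul hd)
  rw [map_add, Finsupp.weight_single] at this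
  simp at this ⊢
  omega

/-- key degree estimate. -/
theorem deriv_estimate (f : Fin n → MvPolynomial (Fin n) K)
    (hf : Function.Surjective
      ⇑(aeval f : MvPolynomial (Fin n) K →ₐ[K] MvPolynomial (Fin n) K))
    (hd : ∀ i, 1 ≤ (f i).totalDegree) (G : MvPolynomial (Fin n) K)
    (hG : 1 ≤ (aeval f G).totalDegree) (i : Fin n) :
    (aeval f (pderiv i G)).totalDegree + (f i).totalDegree ≤
      (aeval f G).totalDegree + ∑ j, ((f j).totalDegree - 1) := by
  classical
  choose g hg using fun l => hf (X l)
  let J : Matrix (Fin n) (Fin n) (MvPolynomial (Fin n) K) := fun j k => pderiv k (f j)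
  let A : Matrix (Fin n) (Fin n) (MvPolynomial (Fin n) K) := fun l j => aeval f (pderiv j (g l))
  have hAJ : A * J = 1 := by
    ext1 l k
    rw [Matrix.mul_apply, ← chain_rule f (g l) k, hg, pderiv_X, Matrix.one_apply, Pi.single_apply]
  have hdet : IsUnit J.det := by
    refine IsUnit.of_mul_eq_one A.det ?_
    rw [mul_comm, ← Matrix.det_mul, hAJ, Matrix.det_one]
  have hdet0 : J.det.totalDegree = 0 := (isUnit_iff_totalDegree_of_isReduced.1 hdet).2
  let v : Fin n → MvPolynomial (Fin n) K := fun j => aeval f (pderiv j G)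
  have hv : Matrix.vecMul v J = fun k => pderiv k (aeval f G) := by
    ext1 k
    rw [chain_rule]
    rfl
  have h2 : J.det • v = Matrix.vecMul (fun k => pderiv k (aeval f G)) J.adjugate := by
    rw [← hv, Matrix.vecMul_vecMul, Matrix.mul_adjugate, Matrix.vecMul_smul, Matrix.vecMul_one]
  have h3 := congrFun h2 i
  let r : Fin n → ℕ := Function.update (fun j => (f j).totalDegree - 1) i 0
  have hr : ∑ j, r j + ((f i).totalDegree - 1) = ∑ j, ((f j).totalDegree - 1) := by
    rw [Finset.sum_update_of_mem (Finset.mem_univ i), zero_add,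
      ← Finset.sum_sdiff (Finset.subset_univ {i}), Finset.sum_singleton]
  have hadj : ∀ k, (J.adjugate k i).totalDegree ≤ ∑ j, r j := by
    intro k
    rw [Matrix.adjugate_apply]
    refine totalDegree_det_le _ r fun a b => ?_
    by_cases hab : a = i
    · subst hab
      rw [Matrix.updateRow_self, Pi.single_apply]
      split_ifs <;> simp
    · rw [Matrix.updateRow_ne hab]
      simp only [r, Function.update_of_ne hab]
      exact totalDegree_pderiv_le _ _
  have h4 : (J.det * v i).totalDegree ≤ ((aeval f G).totalDegree - 1) + ∑ j, r j := by
    have : J.det * v i = ∑ k, pderiv k (aeval f G) * J.adjugate k i := h3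
    rw [this]
    refine totalDegree_finsetSum_le fun k _ => (totalDegree_mul _ _).trans ?_
    exact add_le_add (totalDegree_pderiv_le _ _) (hadj k)
  have h5 : (v i).totalDegree ≤ (J.det * v i).totalDegree := by
    by_cases h0 : v i = 0
    · simp [h0]
    · rw [totalDegree_mul_of_isDomain hdet.ne_zero h0]
      omega
  have h6 := hd i
  change (v i).totalDegree + _ ≤ _
  omega

theorem pderiv_comp {w : Fin n → ℕ} {G : MvPolynomial (Fin n) K} {N : ℕ} (i : Fin n) :
    weightedHomogeneousComponent w N (pderiv i G) =
      pderiv i (weightedHomogeneousComponent w (N + w i) G) := by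
  classical
  ext d
  simp only [coeff_weightedHomogeneousComponent, coeff_pderiv, map_add, Finsupp.weight_single,
    smul_eq_mul, one_mul, add_left_inj]
  split_ifs <;> simp

theorem pderiv_wle {w : Fin n → ℕ} {G : MvPolynomial (Fin n) K} {N : ℕ} (i : Fin n)
    (h : WLe w G (N + w i)) : WLe w (pderiv i G) N := by
  intro d hd
  rw [coeff_pderiv] at hd
  have := h _ (left_ne_zero_of_mul hd)
  rw [map_add, Finsupp.weight_single] at this
  simp at this
  omega

theorem eq_C_of_pderiv [CharZero K] (R : MvPolynomial (Fin n) K)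
    (h : ∀ i, pderiv i R = 0) : R = C (coeff 0 R) := by
  classical
  ext d
  rw [coeff_C]
  split_ifs with hd
  · rw [hd]
  · obtain ⟨i, hi⟩ : ∃ i, d i ≠ 0 := by
      by_contra! hc
      exact hd (by ext i; simp [hc i])
    have := congrArg (coeff (d - Finsupp.single i 1)) (h i)
    rw [coeff_pderiv, Finsupp.sub_add_single_one_cancel hi, coeff_zero] at this
    exact (mul_eq_zero.1 this).resolve_right (Nat.cast_add_one_ne_zero _)


theorem not_dvd_pderiv [CharZero K] {R P : MvPolynomial (Fin n) K} (hR : Prime R) (m : ℕ)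
    (h1 : R ^ (m + 1) ∣ P) (h2 : ¬ R ^ (m + 2) ∣ P) :
    ∃ i, ¬ R ^ (m + 1) ∣ pderiv i P := by
  by_contra! h
  obtain ⟨S, rfl⟩ := h1
  have hS : ¬ R ∣ S := by
    rintro ⟨T, rfl⟩
    exact h2 ⟨T, by ring⟩
  have h3 : ∀ i, R ∣ pderiv i R := by
    intro i
    have h4 := h i
    rw [pderiv_mul, pderiv_pow, Nat.add_sub_cancel] at h4
    have h5 := (Nat.cast_ne_zero (R := K)).2 (Nat.succ_ne_zero m)
    have h6 := (dvd_add_left (Dvd.intro _ rfl)).1 h4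
    have e : ((m + 1 : ℕ) : MvPolynomial (Fin n) K) * R ^ m * pderiv i R * S =
        R ^ m * (C ((m + 1 : ℕ) : K) * (pderiv i R * S)) := by
      rw [map_natCast]; ring
    rw [e, pow_succ, mul_dvd_mul_iff_left (pow_ne_zero _ hR.ne_zero)] at h6
    rcases hR.dvd_or_dvd h6 with h7 | h7
    · exact absurd (isUnit_of_dvd_unit h7 ((isUnit_iff_ne_zero.2 h5).map C)) hR.not_isUnit
    · exact (hR.dvd_or_dvd h7).resolve_right hS
  have h4 : 1 ≤ R.totalDegree := by
    by_contra! hc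
    have h0 : R = C (coeff 0 R) := totalDegree_eq_zero_iff_eq_C.1 (by omega)
    have hne : coeff 0 R ≠ 0 := by
      intro h'
      rw [h', C_0] at h0
      exact hR.ne_zero h0
    exact hR.not_isUnit (h0 ▸ (isUnit_iff_ne_zero.2 hne).map C)
  have h5 : ∀ i, pderiv i R = 0 := by
    intro i
    by_contra hne
    have := totalDegree_le_of_dvd_of_isDomain (h3 i) hne
    have := totalDegree_pderiv_le i R
    omega
  have h6 := eq_C_of_pderiv R h5
  rw [h6, totalDegree_C] at h4
  omega

/-- The parachute inequality. -/
theorem parachute [CharZero K] (f : Fin n → MvPolynomial (Fin n) K)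
    (hf : Function.Bijective
      ⇑(aeval f : MvPolynomial (Fin n) K →ₐ[K] MvPolynomial (Fin n) K))
    (hd : ∀ i, 1 ≤ (f i).totalDegree)
    (R : MvPolynomial (Fin n) K) (hR : Prime R)
    (hI : relIdealStd f = Ideal.span {R}) (m : ℕ) :
    ∀ (N : ℕ) (G : MvPolynomial (Fin n) K), WLe (fun i => (f i).totalDegree) G N →
      ¬ R ^ (m + 1) ∣ weightedHomogeneousComponent (fun i => (f i).totalDegree) N G →
      N ≤ (aeval f G).totalDegree + m * ∑ j, ((f j).totalDegree - 1) := by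
  induction m with
  | zero =>
    intro N G hG hP
    by_contra! hlt
    rw [zero_mul, add_zero] at hlt
    have h1 := comp_aeval f G N hG
    rw [homogeneousComponent_eq_zero _ _ hlt] at h1
    apply hP
    rw [zero_add, pow_one, ← Ideal.mem_span_singleton, ← hI]
    exact h1.symm
  | succ m ih =>
    intro N G hG hP
    by_cases h1 : R ^ (m + 1) ∣ weightedHomogeneousComponent (fun i => (f i).totalDegree) N G
    · obtain ⟨i, hi⟩ := not_dvd_pderiv hR m h1 hP
      have hNi : (f i).totalDegree ≤ N := by
        by_contra! hlt
        apply hi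
        have : pderiv i (weightedHomogeneousComponent (fun i => (f i).totalDegree) N G) = 0 := by
          ext d
          rw [coeff_pderiv, coeff_zero]
          classical
          rw [coeff_weightedHomogeneousComponent, if_neg, zero_mul]
          rw [map_add, Finsupp.weight_single]
          simp only [smul_eq_mul, one_mul]
          omega
        rw [this]
        exact dvd_zero _
      obtain ⟨M, rfl⟩ := Nat.exists_eq_add_of_le' hNi
      rw [← pderiv_comp (w := fun i => (f i).totalDegree)] at hi
      have h2 := ih M (pderiv i G)
        (pderiv_wle (w := fun i => (f i).totalDegree) i hG) hi
      have hG1 : 1 ≤ (aeval f G).totalDegree := by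
        by_contra! hc
        have h0 := totalDegree_eq_zero_iff_eq_C.1 (Nat.lt_one_iff.1 hc)
        have hGC : G = C (coeff 0 (aeval f G)) := by
          apply hf.1
          rw [aeval_C]
          exact h0
        apply hi
        rw [hGC, pderiv_C, map_zero]
        exact dvd_zero _
      have h3 := deriv_estimate f hf.2 hd G hG1 i
      rw [add_mul, one_mul]
      omega
    · have := ih N G hG h1
      rw [add_mul]
      omega

theorem noeth_inj {A : Type*} [CommRing A] [IsNoetherianRing A] (φ : A →+* A)
    (hφ : Function.Surjective φ) : Function.Injective φ := by
  let c : ℕ →o Ideal A :=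
    { toFun := fun k => RingHom.ker (φ ^ k)
      monotone' := monotone_nat_of_le_succ fun k x hx => by
        rw [RingHom.mem_ker] at hx ⊢
        rw [pow_succ', RingHom.mul_def, RingHom.comp_apply, hx, map_zero] }
  obtain ⟨k, hk⟩ := monotone_stabilizes_iff_noetherian.2 ‹_› c
  rw [injective_iff_map_eq_zero]
  intro x hx
  have hs : Function.Surjective ⇑(φ ^ k) := by
    rw [RingHom.coe_pow]
    exact hφ.iterate k
  obtain ⟨y, rfl⟩ := hs x
  have h1 : y ∈ c (k + 1) := by
    change (φ ^ (k + 1)) y = 0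
    rw [pow_succ', RingHom.mul_def, RingHom.comp_apply, hx]
  rw [← hk (k + 1) (Nat.le_succ k)] at h1
  exact h1

end Parachute

/-- Theorem 2: if the ideal of relations is principal, `I = (R)`, then
`deg₂ R ≤ d₁ + ⋯ + dₙ - n + 1`, where `deg₂` is the weighted degree with weights
`dᵢ = deg₁ fᵢ` (the inequality is stated additively to avoid truncated subtraction). -/
theorem stmt1 {K : Type*} [Field K] [IsAlgClosed K] [CharZero K]
    {n : ℕ} (f : Fin n → MvPolynomial (Fin n) K)
    (hf : Function.Bijective
      ⇑(aeval f : MvPolynomial (Fin n) K →ₐ[K] MvPolynomial (Fin n) K))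
    (R : MvPolynomial (Fin n) K)
    (hI : relIdealStd f = Ideal.span {R}) :
    weightedTotalDegree (fun i => (f i).totalDegree) R + n ≤ (∑ i, (f i).totalDegree) + 1 := by
  classical
  have hd : ∀ i, 1 ≤ (f i).totalDegree := by
    intro i
    by_contra! hc
    have h0 := totalDegree_eq_zero_iff_eq_C.1 (Nat.lt_one_iff.1 hc)
    have hX : (X i : MvPolynomial (Fin n) K) = C (coeff 0 (f i)) := by
      apply hf.1
      rw [aeval_C, aeval_X]
      exact h0
    have := congrArg totalDegree hX
    rw [totalDegree_X, totalDegree_C] at this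
    omega
  have hsum : ∑ j, ((f j).totalDegree - 1) + n = ∑ j, (f j).totalDegree := by
    have : ∑ j, (((f j).totalDegree - 1) + 1) = ∑ j, (f j).totalDegree :=
      Finset.sum_congr rfl fun j _ => Nat.sub_add_cancel (hd j)
    rw [← this, Finset.sum_add_distrib]
    simp
  by_cases hR0 : R = 0
  · subst hR0
    rw [weightedTotalDegree_zero, bot_eq_zero]
    omega
  have hR : Prime R := by
    rw [← Ideal.span_singleton_prime hR0, ← hI]
    exact RingHom.ker_isPrime _
  choose g hg using fun l => hf.2 (X l)
  by_cases hall : ∀ l, weightedTotalDegree (fun i => (f i).totalDegree) (g l) ≤ 1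
  · exfalso
    have hsurj : Function.Surjective ⇑(aeval (fun i => ltStd (f i)) :
        MvPolynomial (Fin n) K →ₐ[K] MvPolynomial (Fin n) K) := by
      rw [← AlgHom.range_eq_top, eq_top_iff, ← adjoin_range_X, Algebra.adjoin_le_iff]
      rintro _ ⟨l, rfl⟩
      refine ⟨_, ((comp_aeval f (g l) 1 (wle_iff.2 (hall l))).symm.trans ?_)⟩
      rw [hg]
      exact (isHomogeneous_X K l).weightedHomogeneousComponent_same
    have hinj := noeth_inj
      (aeval (fun i => ltStd (f i)) :
        MvPolynomial (Fin n) K →ₐ[K] MvPolynomial (Fin n) K).toRingHom hsurj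
    apply hR0
    apply hinj
    have : R ∈ relIdealStd f := by rw [hI]; exact Ideal.mem_span_singleton_self R
    rw [map_zero]
    exact this
  · push Not at hall
    obtain ⟨l, hl⟩ := hall
    set w : Fin n → ℕ := fun i => (f i).totalDegree with hw
    have hg0 : g l ≠ 0 := by
      rintro h
      rw [h, weightedTotalDegree_zero, bot_eq_zero] at hl
      omega
    have hP0 := comp_top_ne_zero (w := w) hg0
    set N := weightedTotalDegree w (g l) with hN
    set P := weightedHomogeneousComponent w N (g l) with hP
    have hfin : FiniteMultiplicity R P := FiniteMultiplicity.of_prime_left hR hP0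
    obtain ⟨m, hm1, S, hm2⟩ : ∃ m, ¬ R ^ (m + 1) ∣ P ∧ R ^ m ∣ P :=
      ⟨multiplicity R P, hfin.not_pow_dvd_of_multiplicity_lt (Nat.lt_succ_self _),
        pow_multiplicity_dvd R P⟩
    have h1 := parachute f hf hd R hR hI m N (g l) (wle_iff.2 le_rfl) hm1
    rw [hg, totalDegree_X] at h1
    have hS0 : S ≠ 0 := by
      rintro rfl
      rw [mul_zero] at hm2
      exact hP0 hm2
    have h2 : m * weightedTotalDegree w R ≤ N := by
      have h3 := wdeg_mul (w := w) (pow_ne_zero m hR0) hS0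
      have h4 := wdeg_pow (w := w) hR0 m
      rw [← hm2] at h3
      have h5 : weightedTotalDegree w P ≤ N := by
        rw [← wle_iff]
        intro d hd'
        rw [hP, coeff_weightedHomogeneousComponent] at hd'
        by_contra hne
        rw [if_neg (by omega)] at hd'
        exact hd' rfl
      omega
    have hm : 1 ≤ m := by
      by_contra! hc
      have : m = 0 := by omega
      subst this
      omega
    have h6 : weightedTotalDegree w R ≤ ∑ j, ((f j).totalDegree - 1) + 1 := by
      by_contra! hc
      have : m * (∑ j, ((f j).totalDegree - 1) + 2) ≤ m * weightedTotalDegree w R :=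
        Nat.mul_le_mul_left m (by omega)
      rw [mul_add] at this
      omega
    omega
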